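/- Fix probability vectors p = (p_w, p_d, p_ℓ) and q = (q_w, q_d, q_ℓ) with p_d = q_d = 0, and assume Player 1 is weak, i.e. p_w ≤ p_ℓ and q_w ≤ q_ℓ. Then for every N ≥ 1 the optimal gains satisfy g*_{2N+1} ≤ g*_{2N}. -/

import Mathlib

noncomputable section

open Filter Topology Finset

/-- The sign of an integer score, as a real number (`sgn 0 = 0`). -/
def sgn (x : ℤ) : ℝ := if 0 < x then 1 else if x < 0 then -1 else 0

/-- Expected sign of the score after one more game played with win/draw/loss
probabilities `w, d, l`, starting from score `x`. -/
def stepVal (w d l : ℝ) (x : ℤ) : ℝ := w * sgn (x + 1) + d * sgn x + l * sgn (x - 1)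

/-- Bellman value function with `k` games remaining: `bellman p q k x = V_{N-k}^N(x)`.
With no game remaining the value is the sign of the score; otherwise Player 1 picks the
better of the offensive style `(pw, pd, pl)` and the defensive style `(qw, qd, ql)`. -/
def bellman (pw pd pl qw qd ql : ℝ) : ℕ → ℤ → ℝ
  | 0, x => sgn x
  | k + 1, x =>
      max
        (pw * bellman pw pd pl qw qd ql k (x + 1) + pd * bellman pw pd pl qw qd ql k x +
          pl * bellman pw pd pl qw qd ql k (x - 1))
        (qw * bellman pw pd pl qw qd ql k (x + 1) + qd * bellman pw pd pl qw qd ql k x +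
          ql * bellman pw pd pl qw qd ql k (x - 1))

/-- Optimal gain over `N` games: `g*_N = V_0^N(0)`. -/
def gOpt (pw pd pl qw qd ql : ℝ) (N : ℕ) : ℝ := bellman pw pd pl qw qd ql N 0

/-- The two playing styles of Player 1. -/
inductive Style
  | offense
  | defense
deriving DecidableEq

/-- Selects the probability attached to a style: `a` for offense, `b` for defense. -/
def styleP (a b : ℝ) : Style → ℝ
  | .offense => a
  | .defense => b

/-- Probability mass function of the score process `X_n` under the policy `π`
(playing `π n x` at round `n+1` when the current score is `x`), started at `X_0 = 0`. -/
def polDist (pw pd pl qw qd ql : ℝ) (π : ℕ → ℤ → Style) : ℕ → ℤ → ℝ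
  | 0, x => if x = 0 then 1 else 0
  | n + 1, x =>
      polDist pw pd pl qw qd ql π n (x - 1) * styleP pw qw (π n (x - 1)) +
      polDist pw pd pl qw qd ql π n x * styleP pd qd (π n x) +
      polDist pw pd pl qw qd ql π n (x + 1) * styleP pl ql (π n (x + 1))

/-- Gain of policy `π` over `n` games: `g_n^π = E[sign (X_n)]`. -/
def gPol (pw pd pl qw qd ql : ℝ) (π : ℕ → ℤ → Style) (n : ℕ) : ℝ :=
  ∑' x : ℤ, polDist pw pd pl qw qd ql π n x * sgn x

/-- Probability mass function of the pair (score, switched-to-defense flag) under the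
catenaccio policy: play offense until the score first reaches `+1`, then defense forever. -/
def catDist (pw pd pl qw qd ql : ℝ) : ℕ → ℤ → Bool → ℝ
  | 0, x, b => if x = 0 ∧ b = false then 1 else 0
  | n + 1, x, true =>
      catDist pw pd pl qw qd ql n (x - 1) true * qw +
      catDist pw pd pl qw qd ql n x true * qd +
      catDist pw pd pl qw qd ql n (x + 1) true * ql +
      (if x = 1 then
        catDist pw pd pl qw qd ql n 0 false * pw +
        catDist pw pd pl qw qd ql n 1 false * pd +
        catDist pw pd pl qw qd ql n 2 false * pl
       else 0)
  | n + 1, x, false =>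
      if x = 1 then 0
      else
        catDist pw pd pl qw qd ql n (x - 1) false * pw +
        catDist pw pd pl qw qd ql n x false * pd +
        catDist pw pd pl qw qd ql n (x + 1) false * pl

/-- Gain of the catenaccio policy over `N` games: `g_N^(cat) = E[sign (X_N)]`. -/
def gCat (pw pd pl qw qd ql : ℝ) (N : ℕ) : ℝ :=
  ∑' x : ℤ,
    (catDist pw pd pl qw qd ql N x false + catDist pw pd pl qw qd ql N x true) * sgn x

/-- Gain of the catenaccio+ policy over `N` games: play catenaccio, except that if the
score after `N - 1` games is `0`, the last game is played with the better of the two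
styles (offense if `pw - pl > qw - ql`, defense otherwise). -/
def gCatPlus (pw pd pl qw qd ql : ℝ) : ℕ → ℝ
  | 0 => 0
  | N + 1 =>
      ∑' x : ℤ,
        (catDist pw pd pl qw qd ql N x false *
            (if x = 0 then (if pw - pl > qw - ql then pw - pl else qw - ql)
             else stepVal pw pd pl x) +
          catDist pw pd pl qw qd ql N x true *
            (if x = 0 then (if pw - pl > qw - ql then pw - pl else qw - ql)
             else stepVal qw qd ql x))

/-- Probability mass function of the lazy random walk with i.i.d. increments (+1 with
probability `qw`, 0 with probability `qd`, −1 with probability `ql`), started at `0`. -/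
def walkDist (qw qd ql : ℝ) : ℕ → ℤ → ℝ
  | 0, x => if x = 0 then 1 else 0
  | n + 1, x =>
      walkDist qw qd ql n (x - 1) * qw + walkDist qw qd ql n x * qd +
        walkDist qw qd ql n (x + 1) * ql

/-- Fixed-style gain over `N` games for the walk with step law `(qw, qd, ql)`. -/
def gFixed (qw qd ql : ℝ) (N : ℕ) : ℝ := ∑' x : ℤ, walkDist qw qd ql N x * sgn x

/-- Probability mass function of the lazy random walk with step law `(pw, pd, pl)`,
started at `0` and absorbed (stopped) at the level `+1`.  In particular
`stoppedDist pw pd pl n 1` is the probability that the walk reaches `+1` by time `n`. -/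
def stoppedDist (pw pd pl : ℝ) : ℕ → ℤ → ℝ
  | 0, x => if x = 0 then 1 else 0
  | n + 1, x =>
      if x = 1 then
        stoppedDist pw pd pl n 1 + stoppedDist pw pd pl n 0 * pw +
          stoppedDist pw pd pl n 2 * pl
      else
        (if x - 1 = 1 then 0 else stoppedDist pw pd pl n (x - 1) * pw) +
          stoppedDist pw pd pl n x * pd +
          (if x + 1 = 1 then 0 else stoppedDist pw pd pl n (x + 1) * pl)
/-- Without draws and for a weak Player 1, one more game does not raise the Bellman value at
scores whose parity is that of the number of remaining games. -/
theorem bellman_succ_le_of_even {pw pl qw ql : ℝ}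
    (hpw : 0 ≤ pw) (hpl : 0 ≤ pl) (hp : pw + pl = 1)
    (hqw : 0 ≤ qw) (hql : 0 ≤ ql) (hq : qw + ql = 1)
    (hweakp : pw ≤ pl) (hweakq : qw ≤ ql) (k : ℕ) (x : ℤ) (hx : Even (x + k)) :
    bellman pw 0 pl qw 0 ql (k + 1) x ≤ bellman pw 0 pl qw 0 ql k x := by
  induction k generalizing x with
  | zero =>
    obtain ⟨m, hm⟩ := hx
    rw [Nat.cast_zero, add_zero] at hm
    simp only [bellman]
    rcases lt_trichotomy m 0 with h | h | h
    · have h₁ : sgn (x + 1) = -1 := by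
        rw [sgn, if_neg (by lia), if_pos (by lia)]
      have h₂ : sgn (x - 1) = -1 := by
        rw [sgn, if_neg (by lia), if_pos (by lia)]
      have h₃ : sgn x = -1 := by
        rw [sgn, if_neg (by lia), if_pos (by lia)]
      rw [h₁, h₂, h₃]
      apply max_le <;> linarith
    · obtain rfl : x = 0 := by lia
      apply max_le <;> norm_num [sgn] <;> linarith
    · have h₁ : sgn (x + 1) = 1 := by rw [sgn, if_pos (by lia)]
      have h₂ : sgn (x - 1) = 1 := by rw [sgn, if_pos (by lia)]
      have h₃ : sgn x = 1 := by rw [sgn, if_pos (by lia)]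
      rw [h₁, h₂, h₃]
      apply max_le <;> linarith
  | succ k ih =>
    have hwin := ih (x + 1) (by push_cast at hx; grind)
    have hloss := ih (x - 1) (by push_cast at hx; grind)
    rw [bellman, bellman.eq_2 pw 0 pl qw 0 ql x k]
    simp only [zero_mul, add_zero]
    gcongr

/-- If there are no draws (`pd = qd = 0`) and Player 1 is weak
(`pw ≤ pl`, `qw ≤ ql`), then for every `N ≥ 1`, `g*_{2N+1} ≤ g*_{2N}`. -/
theorem gOpt_odd_le_even_of_no_draws
    (pw pd pl qw qd ql : ℝ)
    (hpw : 0 ≤ pw) (hpd : 0 ≤ pd) (hpl : 0 ≤ pl) (hp : pw + pd + pl = 1)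
    (hqw : 0 ≤ qw) (hqd : 0 ≤ qd) (hql : 0 ≤ ql) (hq : qw + qd + ql = 1)
    (hpd0 : pd = 0) (hqd0 : qd = 0)
    (hweakp : pw ≤ pl) (hweakq : qw ≤ ql)
    (N : ℕ) (hN : 1 ≤ N) :
    gOpt pw pd pl qw qd ql (2 * N + 1) ≤ gOpt pw pd pl qw qd ql (2 * N) := by
  subst hpd0 hqd0
  exact bellman_succ_le_of_even hpw hpl (by linarith) hqw hql (by linarith) hweakp hweakq
    (2 * N) 0 (by simp)
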